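/- Let n₁, n₂, n₃ be even positive integers and let M = n₁n₂n₃/4. Let T₁ = Σ_{i₁=0}^{n₁} Σ_{i₂=0}^{n₂} Σ_{i₃=0}^{n₃} e_{i₁} ⊗ e_{i₂} ⊗ e_{i₃} ⊗ e_{(i₁,i₂,i₃)} ∈ ℂ^{n₁+1} ⊗ ℂ^{n₂+1} ⊗ ℂ^{n₃+1} ⊗ ℂ^{(n₁+1)(n₂+1)(n₃+1)} and let T₂ = Σ_{ℓ=1}^{M} e_ℓ ⊗ e_ℓ ⊗ e_ℓ ⊗ e₀ ∈ ℂ^M ⊗ ℂ^M ⊗ ℂ^M ⊗ ℂ¹. Then R̲(T₁) = (n₁+1)(n₂+1)(n₃+1), R̲(T₂) = M, and R̲(T₁ ⊕ T₂) = (n₁+1)(n₂+1)(n₃+1) + 1. -/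

import Mathlib

open Finset

namespace Subadditivity

noncomputable section

/-- A tensor of order `k` over `ℂ` with `i`-th factor the space `ℂ^{ι i}` of complex-valued
functions on the finite index type `ι i`; the tensor is represented by the array of its
coordinates with respect to the standard basis, i.e. by an element of
`ℂ^{ι 0} ⊗ ⋯ ⊗ ℂ^{ι (k-1)} ≃ ((∀ i, ι i) → ℂ)`. -/
abbrev Tensor {k : ℕ} (ι : Fin k → Type) : Type := (∀ i, ι i) → ℂ

/-- `T` is a sum of `r` simple (rank-one) tensors `v j 0 ⊗ ⋯ ⊗ v j (k-1)`. -/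
def HasRankLE {k : ℕ} {ι : Fin k → Type} (T : Tensor ι) (r : ℕ) : Prop :=
  ∃ v : Fin r → (∀ i, ι i → ℂ), T = fun x => ∑ j : Fin r, ∏ i : Fin k, v j i (x i)

/-- Tensor rank: the least `r` such that `T` is a sum of `r` simple tensors. -/
noncomputable def rank {k : ℕ} {ι : Fin k → Type} (T : Tensor ι) : ℕ :=
  sInf {r | HasRankLE T r}

/-- Border rank is at most `r`: `T` lies in the closure of the set of tensors of rank `≤ r`. -/
def HasBorderRankLE {k : ℕ} {ι : Fin k → Type} (T : Tensor ι) (r : ℕ) : Prop :=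
  T ∈ closure {S : Tensor ι | HasRankLE S r}

/-- Border rank. -/
noncomputable def borderRank {k : ℕ} {ι : Fin k → Type} (T : Tensor ι) : ℕ :=
  sInf {r | HasBorderRankLE T r}

open scoped Classical in
/-- Direct sum of two tensors of order `k`: the coordinates supported on the `ι`-part are
those of `T`, the coordinates supported on the `κ`-part are those of `S`, and all mixed
coordinates vanish. -/
noncomputable def dsum {k : ℕ} {ι κ : Fin k → Type} (T : Tensor ι) (S : Tensor κ) :
    Tensor (fun i => ι i ⊕ κ i) := fun x =>
  (if h : ∃ y : ∀ i, ι i, x = fun i => Sum.inl (y i) then T h.choose else 0) +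
  (if h : ∃ z : ∀ i, κ i, x = fun i => Sum.inr (z i) then S h.choose else 0)

/-- Kronecker product of two tensors of order `k`. -/
def kron {k : ℕ} {ι κ : Fin k → Type} (T : Tensor ι) (S : Tensor κ) :
    Tensor (fun i => ι i × κ i) := fun x =>
  T (fun i => (x i).1) * S (fun i => (x i).2)

/-- `N`-th Kronecker power of a tensor of order `k`. -/
def kpow {k : ℕ} {ι : Fin k → Type} (T : Tensor ι) (N : ℕ) :
    Tensor (fun i => Fin N → ι i) := fun x => ∏ j : Fin N, T (fun i => x i j)

/-- The unit tensor `u_k(r) = Σ_{j=1}^r e_j ⊗ ⋯ ⊗ e_j` of order `k`. -/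
def unit (k r : ℕ) : Tensor (fun _ : Fin k => Fin r) := fun x =>
  ∑ j : Fin r, ∏ i : Fin k, (if x i = j then (1 : ℂ) else 0)

/-- `S` is a degeneration of `T`: `S` lies in the closure of the set of tensors obtained
from `T` by applying linear maps `A i` on each factor. -/
def Degen {k : ℕ} {ι κ : Fin k → Type} [∀ i, Fintype (κ i)]
    (S : Tensor ι) (T : Tensor κ) : Prop :=
  S ∈ closure {S' : Tensor ι | ∃ A : ∀ i, ι i → κ i → ℂ,
    S' = fun x => ∑ y : ∀ i, κ i, (∏ i : Fin k, A i (x i) (y i)) * T y}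

/-- Kronecker delta. -/
def delta {α : Type} [DecidableEq α] (a b : α) : ℂ := if a = b then 1 else 0

/-- The order-4 "spider" tensor
`Σ_{i₁,i₂,i₃} e_{i₁} ⊗ e_{i₂} ⊗ e_{i₃} ⊗ e_{(i₁,i₂,i₃)} ∈ ℂ^{m₁} ⊗ ℂ^{m₂} ⊗ ℂ^{m₃} ⊗ ℂ^{m₁m₂m₃}`,
the last factor being indexed by triples. -/
def spider3 (m₁ m₂ m₃ : ℕ) :
    Tensor ![Fin m₁, Fin m₂, Fin m₃, Fin m₁ × Fin m₂ × Fin m₃] := fun x =>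
  delta (α := Fin m₁ × Fin m₂ × Fin m₃) (x 3) (x 0, x 1, x 2)

/-- The order-4 tensor `Σ_{j=1}^N e_j ⊗ e_j ⊗ e₀ ⊗ e₀ ∈ ℂ^N ⊗ ℂ^N ⊗ ℂ¹ ⊗ ℂ¹`. -/
def matTensor4 (N : ℕ) : Tensor ![Fin N, Fin N, Fin 1, Fin 1] := fun x =>
  delta (α := Fin N) (x 0) (x 1)

/-- The order-4 tensor `Σ_{ℓ=1}^M e_ℓ ⊗ e_ℓ ⊗ e_ℓ ⊗ e₀ ∈ ℂ^M ⊗ ℂ^M ⊗ ℂ^M ⊗ ℂ¹`. -/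
def ghz4 (M : ℕ) : Tensor ![Fin M, Fin M, Fin M, Fin 1] := fun x =>
  delta (α := Fin M) (x 0) (x 1) * delta (α := Fin M) (x 1) (x 2)

/-! ### Direct sums -/

section DirectSum

variable {k : ℕ} {ι κ : Fin k → Type} (T : Tensor ι) (S : Tensor κ)

lemma dsum_inl (i : Fin k) (y : ∀ i, ι i) : dsum T S (fun i => Sum.inl (y i)) = T y := by
  have h : ∃ y' : ∀ i, ι i, (fun i => (Sum.inl (y i) : ι i ⊕ κ i)) = fun i => Sum.inl (y' i) :=
    ⟨y, rfl⟩
  have h' : ¬ ∃ z : ∀ i, κ i, (fun i => (Sum.inl (y i) : ι i ⊕ κ i)) = fun i => Sum.inr (z i) :=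
    fun ⟨z, hz⟩ => Sum.inl_ne_inr (congrFun hz i)
  have hy : h.choose = y := funext fun i => (Sum.inl_injective (congrFun h.choose_spec i)).symm
  rw [dsum, dif_pos h, dif_neg h', hy, add_zero]

lemma dsum_inr (i : Fin k) (z : ∀ i, κ i) : dsum T S (fun i => Sum.inr (z i)) = S z := by
  have h : ∃ z' : ∀ i, κ i, (fun i => (Sum.inr (z i) : ι i ⊕ κ i)) = fun i => Sum.inr (z' i) :=
    ⟨z, rfl⟩
  have h' : ¬ ∃ y : ∀ i, ι i, (fun i => (Sum.inr (z i) : ι i ⊕ κ i)) = fun i => Sum.inl (y i) :=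
    fun ⟨y, hy⟩ => Sum.inr_ne_inl (congrFun hy i)
  have hz : h.choose = z := funext fun i => (Sum.inr_injective (congrFun h.choose_spec i)).symm
  rw [dsum, dif_pos h, dif_neg h', hz, zero_add]

lemma dsum_mixed {x : ∀ i, ι i ⊕ κ i} {i j : Fin k} {y : ι i} {z : κ j}
    (hi : x i = Sum.inl y) (hj : x j = Sum.inr z) : dsum T S x = 0 := by
  have h : ¬ ∃ y : ∀ i, ι i, x = fun i => Sum.inl (y i) := by
    rintro ⟨y', rfl⟩
    exact Sum.inl_ne_inr hj
  have h' : ¬ ∃ z : ∀ i, κ i, x = fun i => Sum.inr (z i) := by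
    rintro ⟨z', rfl⟩
    exact Sum.inr_ne_inl hi
  rw [dsum, dif_neg h, dif_neg h', add_zero]

end DirectSum

/-! ### Tensors of order four -/

/-- The family on `Fin 4` with the given four values. -/
def mk₄ {α : Fin 4 → Type*} (x₀ : α 0) (x₁ : α 1) (x₂ : α 2) (x₃ : α 3) : ∀ i, α i
  | 0 => x₀
  | 1 => x₁
  | 2 => x₂
  | 3 => x₃

lemma dsum_eq_of_four {ι κ : Fin 4 → Type} (T : Tensor ι) (S : Tensor κ)
    (F : (ι 0 ⊕ κ 0) → (ι 1 ⊕ κ 1) → (ι 2 ⊕ κ 2) → (ι 3 ⊕ κ 3) → ℂ)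
    (hT : ∀ y : ∀ i, ι i, F (.inl (y 0)) (.inl (y 1)) (.inl (y 2)) (.inl (y 3)) = T y)
    (hS : ∀ z : ∀ i, κ i, F (.inr (z 0)) (.inr (z 1)) (.inr (z 2)) (.inr (z 3)) = S z)
    (h01 : ∀ y z s t, F (.inl y) (.inr z) s t = 0) (h10 : ∀ y z s t, F (.inr y) (.inl z) s t = 0)
    (h12 : ∀ y z s t, F s (.inl y) (.inr z) t = 0) (h21 : ∀ y z s t, F s (.inr y) (.inl z) t = 0)
    (h23 : ∀ y z s t, F s t (.inl y) (.inr z) = 0) (h32 : ∀ y z s t, F s t (.inr y) (.inl z) = 0)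
    (x : ∀ i, ι i ⊕ κ i) : dsum T S x = F (x 0) (x 1) (x 2) (x 3) := by
  rcases e0 : x 0 with y0 | z0 <;> rcases e1 : x 1 with y1 | z1
  · rcases e2 : x 2 with y2 | z2
    · rcases e3 : x 3 with y3 | z3
      · have hx : x = fun i => Sum.inl (mk₄ (α := ι) y0 y1 y2 y3 i) := by
          funext i
          fin_cases i <;> assumption
        rw [hx, dsum_inl T S 0, ← hT]
        rfl
      · rw [dsum_mixed T S e0 e3, h23]
    · rw [dsum_mixed T S e0 e2, h12]
  · rw [dsum_mixed T S e0 e1, h01]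
  · rw [dsum_mixed T S e1 e0, h10]
  · rcases e2 : x 2 with y2 | z2
    · rw [dsum_mixed T S e2 e1, h21]
    · rcases e3 : x 3 with y3 | z3
      · rw [dsum_mixed T S e3 e2, h32]
      · have hx : x = fun i => Sum.inr (mk₄ (α := κ) z0 z1 z2 z3 i) := by
          funext i
          fin_cases i <;> assumption
        rw [hx, dsum_inr T S 0, ← hS]
        rfl

lemma hasRankLE_of_sum {k : ℕ} {ι : Fin k → Type} {β : Type*} [Fintype β] (T : Tensor ι)
    (v : β → ∀ i, ι i → ℂ) (h : ∀ x, T x = ∑ j, ∏ i, v j i (x i)) :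
    HasRankLE T (Fintype.card β) :=
  ⟨fun j => v ((Fintype.equivFin β).symm j), funext fun x =>
    (h x).trans ((Fintype.equivFin β).symm.sum_comp fun j => ∏ i, v j i (x i)).symm⟩

lemma hasRankLE_four {ι : Fin 4 → Type} {β : Type*} [Fintype β] (T : Tensor ι)
    (v₀ : β → ι 0 → ℂ) (v₁ : β → ι 1 → ℂ) (v₂ : β → ι 2 → ℂ) (v₃ : β → ι 3 → ℂ)
    (h : ∀ x, T x = ∑ j, v₀ j (x 0) * v₁ j (x 1) * v₂ j (x 2) * v₃ j (x 3)) :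
    HasRankLE T (Fintype.card β) :=
  hasRankLE_of_sum T (fun j => mk₄ (α := fun i => ι i → ℂ) (v₀ j) (v₁ j) (v₂ j) (v₃ j))
    fun x => by simp only [h, Fin.prod_univ_four]; rfl

/-! ### Lower bounds from flattenings -/

lemma det_flattening_eq_zero {k : ℕ} {ι : Fin k → Type} {α : Type*} [Fintype α] [DecidableEq α]
    {T : Tensor ι} {r : ℕ} (hT : HasRankLE T r) (hr : r < Fintype.card α) (i₀ : Fin k)
    (p : α → ∀ i, ι i) (q : α → ι i₀) :
    (Matrix.of fun a b => T (Function.update (p a) i₀ (q b))).det = 0 := by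
  obtain ⟨v, rfl⟩ := hT
  have h : (Matrix.of fun a b => ∑ j : Fin r, ∏ i, v j i (Function.update (p a) i₀ (q b) i)) =
      (Matrix.of fun (a : α) (j : Fin r) => ∏ i ∈ univ.erase i₀, v j i (p a i)) *
      (Matrix.of fun (j : Fin r) (b : α) => v j i₀ (q b)) := by
    ext a b
    simp only [Matrix.of_apply, Matrix.mul_apply]
    refine sum_congr rfl fun j _ => ?_
    rw [← prod_erase_mul _ _ (mem_univ i₀), Function.update_self]
    congr 1
    refine prod_congr rfl fun i hi => ?_
    rw [Function.update_of_ne (ne_of_mem_erase hi)]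
  rw [h]
  by_contra hdet
  have h1 := Matrix.rank_of_isUnit _ ((Matrix.isUnit_iff_isUnit_det _).2 (isUnit_iff_ne_zero.2 hdet))
  have h2 := (Matrix.rank_mul_le_left (Matrix.of fun (a : α) (j : Fin r) =>
      ∏ i ∈ univ.erase i₀, v j i (p a i)) (Matrix.of fun (j : Fin r) (b : α) => v j i₀ (q b))).trans
    (Matrix.rank_le_card_width _)
  rw [Fintype.card_fin] at h2
  omega

/-- If some flattening of `T` contains an identity matrix of size `card α`, then the border rank
of `T` is at least `card α`. -/
lemma card_le_of_hasBorderRankLE {k : ℕ} {ι : Fin k → Type} {α : Type*} [Fintype α]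
    [DecidableEq α] {T : Tensor ι} {r : ℕ} (hT : HasBorderRankLE T r) (i₀ : Fin k)
    (p : α → ∀ i, ι i) (q : α → ι i₀)
    (h : ∀ a b, T (Function.update (p a) i₀ (q b)) = if a = b then 1 else 0) :
    Fintype.card α ≤ r := by
  by_contra! hr
  have hclosed : IsClosed {S : Tensor ι |
      (Matrix.of fun a b => S (Function.update (p a) i₀ (q b))).det = 0} := by
    refine isClosed_eq (Continuous.matrix_det ?_) continuous_const
    exact continuous_matrix fun a b => continuous_apply _
  have hdet : T ∈ {S : Tensor ι |
      (Matrix.of fun a b => S (Function.update (p a) i₀ (q b))).det = 0} :=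
    closure_minimal (fun S hS => det_flattening_eq_zero hS hr i₀ p q) hclosed hT
  have h1 : (Matrix.of fun a b => T (Function.update (p a) i₀ (q b))) = 1 := by
    ext a b
    simp [h, Matrix.one_apply]
  rw [Set.mem_ofPred_eq, h1, Matrix.det_one] at hdet
  exact one_ne_zero hdet

lemma borderRank_eq {k : ℕ} {ι : Fin k → Type} {T : Tensor ι} {r : ℕ} (h : HasBorderRankLE T r)
    (h' : ∀ s, HasBorderRankLE T s → r ≤ s) : borderRank T = r :=
  le_antisymm (Nat.sInf_le h) (le_csInf ⟨r, h⟩ h')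

/-! ### The border rank algorithm -/

section Degeneration

variable {A₁ A₂ A₃ : Type*} [Fintype A₁] [Fintype A₂] [Fintype A₃]

/-- The sum conditions on `X`, `Y`, `Z` that kill all terms of degree one and two in the
degeneration. -/
structure BalancedTriple (X Y Z : A₁ → A₂ → A₃ → ℂ) : Prop where
  sum_X : ∀ i₂ i₃, ∑ i₁, X i₁ i₂ i₃ = 0
  sum_Y : ∀ i₁ i₃, ∑ i₂, Y i₁ i₂ i₃ = 0
  sum_Z : ∀ i₁ i₂, ∑ i₃, Z i₁ i₂ i₃ = 0
  sum_XY : ∀ i₃, ∑ i₁, ∑ i₂, X i₁ i₂ i₃ * Y i₁ i₂ i₃ = 0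
  sum_XZ : ∀ i₂, ∑ i₁, ∑ i₃, X i₁ i₂ i₃ * Z i₁ i₂ i₃ = 0
  sum_YZ : ∀ i₁, ∑ i₂, ∑ i₃, Y i₁ i₂ i₃ * Z i₁ i₂ i₃ = 0

lemma BalancedTriple.sum_expand {X Y Z : A₁ → A₂ → A₃ → ℂ} (h : BalancedTriple X Y Z)
    (a : A₁ → ℂ) (b : A₂ → ℂ) (c : A₃ → ℂ) (d : A₁ → A₂ → A₃ → ℂ) (e ε : ℂ) :
    ∑ i₁, ∑ i₂, ∑ i₃, (a i₁ + ε * X i₁ i₂ i₃) * (b i₂ + ε * Y i₁ i₂ i₃) * (c i₃ + ε * Z i₁ i₂ i₃) *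
        (e + ε ^ 3 * d i₁ i₂ i₃) =
      (∑ i, a i) * (∑ i, b i) * (∑ i, c i) * e +
      ε ^ 3 * (∑ i₁, ∑ i₂, ∑ i₃, a i₁ * b i₂ * c i₃ * d i₁ i₂ i₃ +
        e * ∑ i₁, ∑ i₂, ∑ i₃, X i₁ i₂ i₃ * Y i₁ i₂ i₃ * Z i₁ i₂ i₃ +
        ε * ∑ i₁, ∑ i₂, ∑ i₃, d i₁ i₂ i₃ *
          (X i₁ i₂ i₃ * b i₂ * c i₃ + a i₁ * Y i₁ i₂ i₃ * c i₃ + a i₁ * b i₂ * Z i₁ i₂ i₃ +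
            ε * (X i₁ i₂ i₃ * Y i₁ i₂ i₃ * c i₃ + X i₁ i₂ i₃ * b i₂ * Z i₁ i₂ i₃ +
              a i₁ * Y i₁ i₂ i₃ * Z i₁ i₂ i₃) +
            ε ^ 2 * (X i₁ i₂ i₃ * Y i₁ i₂ i₃ * Z i₁ i₂ i₃))) := by
  have hX : ∑ i₁, ∑ i₂, ∑ i₃, X i₁ i₂ i₃ * b i₂ * c i₃ = 0 := by
    rw [sum_comm]
    refine sum_eq_zero fun i₂ _ => ?_
    rw [sum_comm]
    refine sum_eq_zero fun i₃ _ => ?_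
    rw [← sum_mul, ← sum_mul, h.sum_X, zero_mul, zero_mul]
  have hY : ∑ i₁, ∑ i₂, ∑ i₃, a i₁ * Y i₁ i₂ i₃ * c i₃ = 0 := by
    refine sum_eq_zero fun i₁ _ => ?_
    rw [sum_comm]
    refine sum_eq_zero fun i₃ _ => ?_
    rw [← sum_mul, ← mul_sum, h.sum_Y, mul_zero, zero_mul]
  have hZ : ∑ i₁, ∑ i₂, ∑ i₃, a i₁ * b i₂ * Z i₁ i₂ i₃ = 0 := by
    refine sum_eq_zero fun i₁ _ => sum_eq_zero fun i₂ _ => ?_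
    rw [← mul_sum, h.sum_Z, mul_zero]
  have hXY : ∑ i₁, ∑ i₂, ∑ i₃, X i₁ i₂ i₃ * Y i₁ i₂ i₃ * c i₃ = 0 := by
    rw [sum_congr rfl fun i₁ _ => sum_comm, sum_comm]
    refine sum_eq_zero fun i₃ _ => ?_
    simp_rw [← sum_mul]
    rw [h.sum_XY, zero_mul]
  have hXZ : ∑ i₁, ∑ i₂, ∑ i₃, X i₁ i₂ i₃ * b i₂ * Z i₁ i₂ i₃ = 0 := by
    rw [sum_comm]
    refine sum_eq_zero fun i₂ _ => ?_
    simp_rw [mul_right_comm _ (b i₂), ← sum_mul]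
    rw [h.sum_XZ, zero_mul]
  have hYZ : ∑ i₁, ∑ i₂, ∑ i₃, a i₁ * Y i₁ i₂ i₃ * Z i₁ i₂ i₃ = 0 := by
    refine sum_eq_zero fun i₁ _ => ?_
    simp_rw [mul_assoc, ← mul_sum]
    rw [h.sum_YZ, mul_zero]
  have habc : (∑ i, a i) * (∑ i, b i) * (∑ i, c i) =
      ∑ i₁, ∑ i₂, ∑ i₃, a i₁ * b i₂ * c i₃ := by
    simp_rw [sum_mul_sum, sum_mul]
    exact sum_congr rfl fun _ _ => sum_comm
  calc _ = (∑ i₁, ∑ i₂, ∑ i₃, a i₁ * b i₂ * c i₃) * e +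
      ε * e * (∑ i₁, ∑ i₂, ∑ i₃, X i₁ i₂ i₃ * b i₂ * c i₃ +
        ∑ i₁, ∑ i₂, ∑ i₃, a i₁ * Y i₁ i₂ i₃ * c i₃ +
        ∑ i₁, ∑ i₂, ∑ i₃, a i₁ * b i₂ * Z i₁ i₂ i₃) +
      ε ^ 2 * e * (∑ i₁, ∑ i₂, ∑ i₃, X i₁ i₂ i₃ * Y i₁ i₂ i₃ * c i₃ +
        ∑ i₁, ∑ i₂, ∑ i₃, X i₁ i₂ i₃ * b i₂ * Z i₁ i₂ i₃ +
        ∑ i₁, ∑ i₂, ∑ i₃, a i₁ * Y i₁ i₂ i₃ * Z i₁ i₂ i₃) +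
      ε ^ 3 * (∑ i₁, ∑ i₂, ∑ i₃, a i₁ * b i₂ * c i₃ * d i₁ i₂ i₃ +
        e * ∑ i₁, ∑ i₂, ∑ i₃, X i₁ i₂ i₃ * Y i₁ i₂ i₃ * Z i₁ i₂ i₃ +
        ε * ∑ i₁, ∑ i₂, ∑ i₃, d i₁ i₂ i₃ *
          (X i₁ i₂ i₃ * b i₂ * c i₃ + a i₁ * Y i₁ i₂ i₃ * c i₃ + a i₁ * b i₂ * Z i₁ i₂ i₃ +
            ε * (X i₁ i₂ i₃ * Y i₁ i₂ i₃ * c i₃ + X i₁ i₂ i₃ * b i₂ * Z i₁ i₂ i₃ +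
              a i₁ * Y i₁ i₂ i₃ * Z i₁ i₂ i₃) +
            ε ^ 2 * (X i₁ i₂ i₃ * Y i₁ i₂ i₃ * Z i₁ i₂ i₃))) := by
        simp only [sum_mul, mul_sum, ← sum_add_distrib]
        refine sum_congr rfl fun i₁ _ => sum_congr rfl fun i₂ _ => sum_congr rfl fun i₃ _ => ?_
        ring
    _ = _ := by
        rw [hX, hY, hZ, hXY, hXZ, hYZ, habc]
        ring


/-- Upper bound for the border rank of the direct sum of a tensor of order four of rank at most
`|A₁| |A₂| |A₃|` and a tensor with one-dimensional last factor. -/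
theorem hasBorderRankLE_dsum {ι κ : Fin 4 → Type} [∀ i, Nonempty (κ i)]
    {T : Tensor ι} {S : Tensor κ}
    (a : A₁ → ι 0 → ℂ) (b : A₂ → ι 1 → ℂ) (c : A₃ → ι 2 → ℂ) (d : A₁ → A₂ → A₃ → ι 3 → ℂ)
    (X : A₁ → A₂ → A₃ → κ 0 → ℂ) (Y : A₁ → A₂ → A₃ → κ 1 → ℂ) (Z : A₁ → A₂ → A₃ → κ 2 → ℂ)
    (e : κ 3 → ℂ)
    (hT : ∀ y, T y = ∑ i₁, ∑ i₂, ∑ i₃, a i₁ (y 0) * b i₂ (y 1) * c i₃ (y 2) * d i₁ i₂ i₃ (y 3))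
    (hS : ∀ z, S z =
      e (z 3) * ∑ i₁, ∑ i₂, ∑ i₃, X i₁ i₂ i₃ (z 0) * Y i₁ i₂ i₃ (z 1) * Z i₁ i₂ i₃ (z 2))
    (h : ∀ s t u, BalancedTriple (X · · · s) (Y · · · t) (Z · · · u)) :
    HasBorderRankLE (dsum T S) (Fintype.card A₁ * Fintype.card A₂ * Fintype.card A₃ + 1) := by
  let a' : A₁ → ι 0 ⊕ κ 0 → ℂ := fun i => Sum.elim (a i) 0
  let b' : A₂ → ι 1 ⊕ κ 1 → ℂ := fun i => Sum.elim (b i) 0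
  let c' : A₃ → ι 2 ⊕ κ 2 → ℂ := fun i => Sum.elim (c i) 0
  let d' : A₁ → A₂ → A₃ → ι 3 ⊕ κ 3 → ℂ := fun i j k => Sum.elim (d i j k) 0
  let X' : A₁ → A₂ → A₃ → ι 0 ⊕ κ 0 → ℂ := fun i j k => Sum.elim 0 (X i j k)
  let Y' : A₁ → A₂ → A₃ → ι 1 ⊕ κ 1 → ℂ := fun i j k => Sum.elim 0 (Y i j k)
  let Z' : A₁ → A₂ → A₃ → ι 2 ⊕ κ 2 → ℂ := fun i j k => Sum.elim 0 (Z i j k)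
  let e' : ι 3 ⊕ κ 3 → ℂ := Sum.elim 0 e
  have h' : ∀ s t u, BalancedTriple (X' · · · s) (Y' · · · t) (Z' · · · u) := by
    intro s t u
    let s₀ : κ 0 := Classical.arbitrary _
    let t₀ : κ 1 := Classical.arbitrary _
    let u₀ : κ 2 := Classical.arbitrary _
    constructor
    · rcases s with _ | s
      · simp [X']
      · exact (h s t₀ u₀).sum_X
    · rcases t with _ | t
      · simp [Y']
      · exact (h s₀ t u₀).sum_Y
    · rcases u with _ | u
      · simp [Z']
      · exact (h s₀ t₀ u).sum_Z
    · rcases s with _ | s <;> rcases t with _ | t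
      any_goals simp [X', Y']
      exact (h s t u₀).sum_XY
    · rcases s with _ | s <;> rcases u with _ | u
      any_goals simp [X', Z']
      exact (h s t₀ u).sum_XZ
    · rcases t with _ | t <;> rcases u with _ | u
      any_goals simp [Y', Z']
      exact (h s₀ t u).sum_YZ
  let G : ℂ → Tensor (fun i => ι i ⊕ κ i) := fun ε x =>
    ∑ i₁, ∑ i₂, ∑ i₃, a' i₁ (x 0) * b' i₂ (x 1) * c' i₃ (x 2) * d' i₁ i₂ i₃ (x 3) +
    e' (x 3) * ∑ i₁, ∑ i₂, ∑ i₃, X' i₁ i₂ i₃ (x 0) * Y' i₁ i₂ i₃ (x 1) * Z' i₁ i₂ i₃ (x 2) +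
    ε * ∑ i₁, ∑ i₂, ∑ i₃, d' i₁ i₂ i₃ (x 3) *
      (X' i₁ i₂ i₃ (x 0) * b' i₂ (x 1) * c' i₃ (x 2) +
        a' i₁ (x 0) * Y' i₁ i₂ i₃ (x 1) * c' i₃ (x 2) +
        a' i₁ (x 0) * b' i₂ (x 1) * Z' i₁ i₂ i₃ (x 2) +
        ε * (X' i₁ i₂ i₃ (x 0) * Y' i₁ i₂ i₃ (x 1) * c' i₃ (x 2) +
          X' i₁ i₂ i₃ (x 0) * b' i₂ (x 1) * Z' i₁ i₂ i₃ (x 2) +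
          a' i₁ (x 0) * Y' i₁ i₂ i₃ (x 1) * Z' i₁ i₂ i₃ (x 2)) +
        ε ^ 2 * (X' i₁ i₂ i₃ (x 0) * Y' i₁ i₂ i₃ (x 1) * Z' i₁ i₂ i₃ (x 2)))
  have hG0 : G 0 = dsum T S := by
    funext x
    rw [dsum_eq_of_four T S (fun x₀ x₁ x₂ x₃ =>
      ∑ i₁, ∑ i₂, ∑ i₃, a' i₁ x₀ * b' i₂ x₁ * c' i₃ x₂ * d' i₁ i₂ i₃ x₃ +
      e' x₃ * ∑ i₁, ∑ i₂, ∑ i₃, X' i₁ i₂ i₃ x₀ * Y' i₁ i₂ i₃ x₁ * Z' i₁ i₂ i₃ x₂)]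
    · simp [G]
    · intro y
      simp [a', b', c', d', e', hT]
    · intro z
      simp [a', X', Y', Z', e', hS]
    all_goals
      intros
      simp [a', b', c', d', X', Y', Z', e']
  have hG : Continuous G := by
    refine continuous_pi fun x => ?_
    fun_prop
  rw [HasBorderRankLE, ← hG0]
  refine mem_closure_of_tendsto (b := nhdsWithin (0 : ℂ) {0}ᶜ)
    (hG.continuousAt.mono_left nhdsWithin_le_nhds) ?_
  filter_upwards [self_mem_nhdsWithin] with ε hε
  have hε : ε ≠ 0 := hε
  have hcard : Fintype.card (Option (A₁ × A₂ × A₃)) =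
      Fintype.card A₁ * Fintype.card A₂ * Fintype.card A₃ + 1 := by
    simp [mul_assoc]
  rw [← hcard]
  refine hasRankLE_four _
    (fun j s => j.elim (-((ε ^ 3)⁻¹ * ∑ i, a' i s))
      fun i => (ε ^ 3)⁻¹ * (a' i.1 s + ε * X' i.1 i.2.1 i.2.2 s))
    (fun j s => j.elim (∑ i, b' i s) fun i => b' i.2.1 s + ε * Y' i.1 i.2.1 i.2.2 s)
    (fun j s => j.elim (∑ i, c' i s) fun i => c' i.2.2 s + ε * Z' i.1 i.2.1 i.2.2 s)
    (fun j s => j.elim (e' s) fun i => e' s + ε ^ 3 * d' i.1 i.2.1 i.2.2 s) fun x => ?_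
  have hexp := (h' (x 0) (x 1) (x 2)).sum_expand (a' · (x 0)) (b' · (x 1)) (c' · (x 2))
    (d' · · · (x 3)) (e' (x 3)) ε
  have hfactor : ∑ i₁, ∑ i₂, ∑ i₃, (ε ^ 3)⁻¹ * (a' i₁ (x 0) + ε * X' i₁ i₂ i₃ (x 0)) *
      (b' i₂ (x 1) + ε * Y' i₁ i₂ i₃ (x 1)) * (c' i₃ (x 2) + ε * Z' i₁ i₂ i₃ (x 2)) *
      (e' (x 3) + ε ^ 3 * d' i₁ i₂ i₃ (x 3)) =
      (ε ^ 3)⁻¹ * ∑ i₁, ∑ i₂, ∑ i₃, (a' i₁ (x 0) + ε * X' i₁ i₂ i₃ (x 0)) *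
      (b' i₂ (x 1) + ε * Y' i₁ i₂ i₃ (x 1)) * (c' i₃ (x 2) + ε * Z' i₁ i₂ i₃ (x 2)) *
      (e' (x 3) + ε ^ 3 * d' i₁ i₂ i₃ (x 3)) := by
    simp only [mul_sum, mul_assoc]
  simp only [G, Fintype.sum_option, Fintype.sum_prod_type, Option.elim_none, Option.elim_some]
  rw [hfactor, hexp]
  field_simp
  ring

end Degeneration

/-! ### The combinatorial design -/

section Extend

variable {P₁ P₂ P₃ : Type*} [Fintype P₁] [Fintype P₂] [Fintype P₃]

/-- Extension of `x` to `none` such that the sums over the first index vanish. -/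
def extend₁ (x : P₁ → P₂ → P₃ → ℂ) : Option P₁ → Option P₂ → Option P₃ → ℂ
  | some p₁, some p₂, some p₃ => x p₁ p₂ p₃
  | none, some p₂, some p₃ => -∑ p₁, x p₁ p₂ p₃
  | _, none, _ => 0
  | _, some _, none => 0

/-- Extension of `y` to `none` such that the sums over the second index vanish. -/
def extend₂ (y : P₁ → P₂ → P₃ → ℂ) : Option P₁ → Option P₂ → Option P₃ → ℂ :=
  fun i₁ i₂ i₃ => extend₁ (fun p₂ p₁ p₃ => y p₁ p₂ p₃) i₂ i₁ i₃

/-- Extension of `z` to `none` such that the sums over the third index vanish. -/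
def extend₃ (z : P₁ → P₂ → P₃ → ℂ) : Option P₁ → Option P₂ → Option P₃ → ℂ :=
  fun i₁ i₂ i₃ => extend₁ (fun p₃ p₁ p₂ => z p₁ p₂ p₃) i₃ i₁ i₂

lemma balancedTriple_extend {x y z : P₁ → P₂ → P₃ → ℂ}
    (hxy : ∀ p₃, ∑ p₁, ∑ p₂, x p₁ p₂ p₃ * y p₁ p₂ p₃ = 0)
    (hxz : ∀ p₂, ∑ p₁, ∑ p₃, x p₁ p₂ p₃ * z p₁ p₂ p₃ = 0)
    (hyz : ∀ p₁, ∑ p₂, ∑ p₃, y p₁ p₂ p₃ * z p₁ p₂ p₃ = 0) :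
    BalancedTriple (extend₁ x) (extend₂ y) (extend₃ z) := by
  constructor
  · rintro (_ | i) (_ | j) <;> simp [extend₁]
  · rintro (_ | i) (_ | j) <;> simp [extend₂, extend₁]
  · rintro (_ | i) (_ | j) <;> simp [extend₃, extend₁]
  · rintro (_ | i) <;> simp [extend₁, extend₂, hxy]
  · rintro (_ | i) <;> simp [extend₁, extend₃, hxz]
  · rintro (_ | i) <;> simp [extend₁, extend₂, extend₃, hyz]

lemma sum_extend (x y z : P₁ → P₂ → P₃ → ℂ) :
    ∑ i₁, ∑ i₂, ∑ i₃, extend₁ x i₁ i₂ i₃ * extend₂ y i₁ i₂ i₃ * extend₃ z i₁ i₂ i₃ =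
      ∑ p₁, ∑ p₂, ∑ p₃, x p₁ p₂ p₃ * y p₁ p₂ p₃ * z p₁ p₂ p₃ := by
  simp [extend₁, extend₂, extend₃]

end Extend

/-- The sign of a bit. -/
def sgn (b : Bool) : ℂ := if b then -1 else 1

section Cube

variable {K₁ K₂ K₃ : Type*} [DecidableEq K₁] [DecidableEq K₂] [DecidableEq K₃]

/-- The function `f` of the bits, restricted to those four vertices of parity `l.2.2.2` of the
`2 × 2 × 2` cube at position `(l.1, l.2.1, l.2.2.1)`. -/
def onTetrahedron (f : Bool → Bool → Bool → ℂ) (l : K₁ × K₂ × K₃ × Bool)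
    (p₁ : K₁ × Bool) (p₂ : K₂ × Bool) (p₃ : K₃ × Bool) : ℂ :=
  if p₁.1 = l.1 ∧ p₂.1 = l.2.1 ∧ p₃.1 = l.2.2.1 then
    if (p₁.2 ^^ p₂.2 ^^ p₃.2) = l.2.2.2 then f p₁.2 p₂.2 p₃.2 else 0
  else 0

/-- The first vectors of the design. -/
def designX (l : K₁ × K₂ × K₃ × Bool) : K₁ × Bool → K₂ × Bool → K₃ × Bool → ℂ :=
  onTetrahedron (fun _ b₂ _ => sgn b₂) l

/-- The second vectors of the design. -/
def designY (l : K₁ × K₂ × K₃ × Bool) : K₁ × Bool → K₂ × Bool → K₃ × Bool → ℂ :=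
  onTetrahedron (fun _ _ b₃ => sgn b₃) l

/-- The third vectors of the design. -/
def designZ (l : K₁ × K₂ × K₃ × Bool) : K₁ × Bool → K₂ × Bool → K₃ × Bool → ℂ :=
  onTetrahedron (fun b₁ _ _ => sgn b₁ * sgn l.2.2.2 / 4) l

variable [Fintype K₁] [Fintype K₂] [Fintype K₃]

lemma sum_sum_prod_bool_eq_zero {K K' : Type*} [Fintype K] [Fintype K']
    {F : K × Bool → K' × Bool → ℂ} (h : ∀ k k', ∑ b, ∑ b', F (k, b) (k', b') = 0) :
    ∑ p, ∑ p', F p p' = 0 := by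
  simp only [Fintype.sum_prod_type]
  refine sum_eq_zero fun k _ => ?_
  rw [sum_comm]
  exact sum_eq_zero fun k' _ => h k k'

lemma balancedTriple_design (l l' l'' : K₁ × K₂ × K₃ × Bool) :
    BalancedTriple (extend₁ (designX l)) (extend₂ (designY l')) (extend₃ (designZ l'')) := by
  obtain ⟨j₁, j₂, j₃, t⟩ := l
  obtain ⟨j₁', j₂', j₃', t'⟩ := l'
  obtain ⟨j₁'', j₂'', j₃'', t''⟩ := l''
  apply balancedTriple_extend
  · rintro ⟨k₃, b₃⟩
    refine sum_sum_prod_bool_eq_zero fun k₁ k₂ => ?_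
    simp only [designX, designY, onTetrahedron]
    split_ifs
    · cases t <;> cases t' <;> cases b₃ <;> norm_num [sgn]
    all_goals simp
  · rintro ⟨k₂, b₂⟩
    refine sum_sum_prod_bool_eq_zero fun k₁ k₃ => ?_
    simp only [designX, designZ, onTetrahedron]
    split_ifs
    · cases t <;> cases t'' <;> cases b₂ <;> norm_num [sgn]
    all_goals simp
  · rintro ⟨k₁, b₁⟩
    refine sum_sum_prod_bool_eq_zero fun k₂ k₃ => ?_
    simp only [designY, designZ, onTetrahedron]
    split_ifs
    · cases t' <;> cases t'' <;> cases b₁ <;> norm_num [sgn]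
    all_goals simp

lemma sum_prod_bool_eq {K : Type*} [Fintype K] {F : K × Bool → ℂ} (j : K)
    (h : ∀ k ≠ j, ∀ b, F (k, b) = 0) : ∑ p, F p = F (j, true) + F (j, false) := by
  rw [Fintype.sum_prod_type, Fintype.sum_eq_single j fun k hk => sum_eq_zero fun b _ => h k hk b,
    Fintype.sum_bool]

lemma sum_design (l l' l'' : K₁ × K₂ × K₃ × Bool) :
    ∑ p₁, ∑ p₂, ∑ p₃, designX l p₁ p₂ p₃ * designY l' p₁ p₂ p₃ * designZ l'' p₁ p₂ p₃ =
      if l = l' ∧ l' = l'' then 1 else 0 := by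
  by_cases h : l = l' ∧ l' = l''
  · obtain ⟨rfl, rfl⟩ := h
    obtain ⟨j₁, j₂, j₃, t⟩ := l
    rw [if_pos ⟨rfl, rfl⟩]
    rw [sum_prod_bool_eq j₁, sum_prod_bool_eq j₂, sum_prod_bool_eq j₂, sum_prod_bool_eq j₃,
      sum_prod_bool_eq j₃, sum_prod_bool_eq j₃, sum_prod_bool_eq j₃]
    · cases t <;> norm_num [designX, designY, designZ, onTetrahedron, sgn]
    all_goals
      intro k hk b
      simp [designX, onTetrahedron, hk]
  · rw [if_neg h]
    refine sum_eq_zero fun p₁ _ => sum_eq_zero fun p₂ _ => sum_eq_zero fun p₃ _ => ?_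
    simp only [designX, designY, designZ, onTetrahedron]
    split_ifs <;> simp_all [Prod.ext_iff]

end Cube

/-! ### The border ranks -/

section Values

lemma update_mk₄_zero {α : Fin 4 → Type*} (x₀ y : α 0) (x₁ : α 1) (x₂ : α 2) (x₃ : α 3) :
    Function.update (mk₄ x₀ x₁ x₂ x₃) 0 y = mk₄ y x₁ x₂ x₃ := by
  funext i
  fin_cases i <;> rfl

lemma update_mk₄_three {α : Fin 4 → Type*} (x₀ : α 0) (x₁ : α 1) (x₂ : α 2) (x₃ y : α 3) :
    Function.update (mk₄ x₀ x₁ x₂ x₃) 3 y = mk₄ x₀ x₁ x₂ y := by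
  funext i
  fin_cases i <;> rfl

lemma sum_delta_prod {α β γ : Type} [Fintype α] [Fintype β] [Fintype γ] [DecidableEq α]
    [DecidableEq β] [DecidableEq γ] (x₀ : α) (x₁ : β) (x₂ : γ) (x₃ : α × β × γ) :
    ∑ j : α × β × γ, delta x₀ j.1 * delta x₁ j.2.1 * delta x₂ j.2.2 * delta x₃ j =
      delta x₃ (x₀, x₁, x₂) := by
  rw [Fintype.sum_eq_single (x₀, x₁, x₂) fun j hj => ?_]
  · simp [delta]
  · simp only [delta, mul_ite, mul_one, mul_zero]
    split_ifs <;> simp_all [Prod.ext_iff]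

lemma sum_delta_three {α : Type} [Fintype α] [DecidableEq α] (x₀ x₁ x₂ : α) :
    ∑ j : α, delta x₀ j * delta x₁ j * delta x₂ j * 1 = delta x₀ x₁ * delta x₁ x₂ := by
  rw [Fintype.sum_eq_single x₁ fun j hj => by simp [delta, hj.symm]]
  simp [delta, eq_comm]

theorem borderRank_spider3 (m₁ m₂ m₃ : ℕ) : borderRank (spider3 m₁ m₂ m₃) = m₁ * m₂ * m₃ := by
  have hcard : Fintype.card (Fin m₁ × Fin m₂ × Fin m₃) = m₁ * m₂ * m₃ := by
    simp [mul_assoc]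
  rw [← hcard]
  refine borderRank_eq (subset_closure ?_) fun s hs => ?_
  · refine hasRankLE_four _ (fun j (s : Fin m₁) => delta s j.1) (fun j (s : Fin m₂) => delta s j.2.1)
      (fun j (s : Fin m₃) => delta s j.2.2) (fun j (s : Fin m₁ × Fin m₂ × Fin m₃) => delta s j)
      fun x => ?_
    exact (sum_delta_prod (α := Fin m₁) (β := Fin m₂) (γ := Fin m₃)
      (x 0) (x 1) (x 2) (x 3)).symm
  · refine card_le_of_hasBorderRankLE hs 3
      (fun a => mk₄ (α := ![Fin m₁, Fin m₂, Fin m₃, Fin m₁ × Fin m₂ × Fin m₃]) a.1 a.2.1 a.2.2 a)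
      (fun b => b) fun a b => ?_
    refine (congrArg _ (update_mk₄_three _ _ _ _ _)).trans ?_
    change delta (α := Fin m₁ × Fin m₂ × Fin m₃) b a = _
    exact if_congr eq_comm rfl rfl

theorem borderRank_ghz4 (M : ℕ) : borderRank (ghz4 M) = M := by
  conv_rhs => rw [← Fintype.card_fin M]
  refine borderRank_eq (subset_closure ?_) fun s hs => ?_
  · refine hasRankLE_four _ (fun j (s : Fin M) => delta s j) (fun j (s : Fin M) => delta s j)
      (fun j (s : Fin M) => delta s j) (fun _ _ => 1) fun x => ?_
    exact (sum_delta_three (α := Fin M) (x 0) (x 1) (x 2)).symm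
  · refine card_le_of_hasBorderRankLE hs 0
      (fun a => mk₄ (α := ![Fin M, Fin M, Fin M, Fin 1]) a a a (0 : Fin 1))
      (fun b => b) fun a b => ?_
    refine (congrArg _ (update_mk₄_zero _ _ _ _ _)).trans ?_
    change delta b a * delta a a = _
    simp [delta, eq_comm]

lemma le_of_hasBorderRankLE_dsum {m₁ m₂ m₃ M r : ℕ} (hM : 0 < M)
    (h : HasBorderRankLE (dsum (spider3 m₁ m₂ m₃) (ghz4 M)) r) : m₁ * m₂ * m₃ + 1 ≤ r := by
  have hcard : Fintype.card ((Fin m₁ × Fin m₂ × Fin m₃) ⊕ Fin 1) = m₁ * m₂ * m₃ + 1 := by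
    simp [mul_assoc]
  rw [← hcard]
  let ι : Fin 4 → Type := ![Fin m₁, Fin m₂, Fin m₃, Fin m₁ × Fin m₂ × Fin m₃]
  let κ : Fin 4 → Type := ![Fin M, Fin M, Fin M, Fin 1]
  let z : Fin M := ⟨0, hM⟩
  refine card_le_of_hasBorderRankLE h 3
    (Sum.elim (fun a i => Sum.inl (mk₄ (α := ι) a.1 a.2.1 a.2.2 a i))
      (fun a i => Sum.inr (mk₄ (α := κ) z z z a i)))
    (fun b => b) ?_
  rintro (a | a) (b | b)
  · have : Function.update (fun i => (Sum.inl (mk₄ (α := ι) a.1 a.2.1 a.2.2 a i) : ι i ⊕ κ i)) 3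
        (Sum.inl b) = fun i => Sum.inl (mk₄ (α := ι) a.1 a.2.1 a.2.2 b i) := by
      funext i
      fin_cases i <;> rfl
    refine (congrArg _ this).trans ((dsum_inl _ _ 0 _).trans ?_)
    change delta (α := Fin m₁ × Fin m₂ × Fin m₃) b a = _
    exact if_congr (by simp [eq_comm]) rfl rfl
  · exact (dsum_mixed _ _ (i := 0) (j := 3) rfl rfl).trans (by simp)
  · exact (dsum_mixed _ _ (i := 3) (j := 0) rfl rfl).trans (by simp)
  · have : Function.update (fun i => (Sum.inr (mk₄ (α := κ) z z z a i) : ι i ⊕ κ i)) 3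
        (Sum.inr b) = fun i => Sum.inr (mk₄ (α := κ) z z z b i) := by
      funext i
      fin_cases i <;> rfl
    refine (congrArg _ this).trans ((dsum_inr _ _ 0 _).trans ?_)
    change delta z z * delta z z = _
    simp [delta, Subsingleton.elim a b]

lemma hasBorderRankLE_dsum_spider3_ghz4 {m₁ m₂ m₃ k₁ k₂ k₃ M : ℕ} (hm₁ : m₁ = 2 * k₁ + 1)
    (hm₂ : m₂ = 2 * k₂ + 1) (hm₃ : m₃ = 2 * k₃ + 1) (hM : M = 2 * (k₁ * k₂ * k₃)) (hM0 : 0 < M) :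
    HasBorderRankLE (dsum (spider3 m₁ m₂ m₃) (ghz4 M)) (m₁ * m₂ * m₃ + 1) := by
  have hc₁ : Fintype.card (Option (Fin k₁ × Bool)) = m₁ := by simp; omega
  have hc₂ : Fintype.card (Option (Fin k₂ × Bool)) = m₂ := by simp; omega
  have hc₃ : Fintype.card (Option (Fin k₃ × Bool)) = m₃ := by simp; omega
  have hc : Fintype.card (Fin k₁ × Fin k₂ × Fin k₃ × Bool) = M := by simp [hM]; ring
  let e₁ := Fintype.equivFinOfCardEq hc₁
  let e₂ := Fintype.equivFinOfCardEq hc₂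
  let e₃ := Fintype.equivFinOfCardEq hc₃
  let e := (Fintype.equivFinOfCardEq hc).symm
  have : ∀ i, Nonempty ((![Fin M, Fin M, Fin M, Fin 1] : Fin 4 → Type) i) := by
    intro i
    have : Nonempty (Fin M) := ⟨⟨0, hM0⟩⟩
    fin_cases i
    · exact this
    · exact this
    · exact this
    · exact ⟨(0 : Fin 1)⟩
  have key := hasBorderRankLE_dsum (T := spider3 m₁ m₂ m₃) (S := ghz4 M)
    (fun i (s : Fin m₁) => delta s (e₁ i)) (fun i (s : Fin m₂) => delta s (e₂ i))
    (fun i (s : Fin m₃) => delta s (e₃ i))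
    (fun i j k (s : Fin m₁ × Fin m₂ × Fin m₃) => delta s (e₁ i, e₂ j, e₃ k))
    (fun i j k (s : Fin M) => extend₁ (designX (e s)) i j k)
    (fun i j k (s : Fin M) => extend₂ (designY (e s)) i j k)
    (fun i j k (s : Fin M) => extend₃ (designZ (e s)) i j k)
    (fun _ => 1) ?_ ?_ fun s t u => balancedTriple_design (e s) (e t) (e u)
  · rwa [hc₁, hc₂, hc₃] at key
  · intro y
    have key : ∀ (s : Fin m₁) (t : Fin m₂) (u : Fin m₃) (v : Fin m₁ × Fin m₂ × Fin m₃),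
        delta v (s, t, u) = ∑ i, ∑ j, ∑ k,
          delta s (e₁ i) * delta t (e₂ j) * delta u (e₃ k) * delta v (e₁ i, e₂ j, e₃ k) := by
      intro s t u v
      rw [← sum_delta_prod, ← (e₁.prodCongr (e₂.prodCongr e₃)).sum_comp]
      simp only [Fintype.sum_prod_type, Equiv.prodCongr_apply, Prod.map]
    exact key (y 0) (y 1) (y 2) (y 3)
  · intro z
    have key : ∀ s t u : Fin M, delta s t * delta t u =
        1 * ∑ i₁, ∑ i₂, ∑ i₃, extend₁ (designX (e s)) i₁ i₂ i₃ *
          extend₂ (designY (e t)) i₁ i₂ i₃ * extend₃ (designZ (e u)) i₁ i₂ i₃ := by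
      intro s t u
      rw [one_mul, sum_extend, sum_design]
      simp only [e.injective.eq_iff, delta, ite_and, ite_mul, one_mul, zero_mul]
    exact key (z 0) (z 1) (z 2)

end Values

/-- Construction 4 for even dimensions. For `n₁, n₂, n₃` even and
positive and `M = n₁n₂n₃/4`:
`R̲(T₁) = (n₁+1)(n₂+1)(n₃+1)`, `R̲(T₂) = M`, and
`R̲(T₁ ⊕ T₂) = (n₁+1)(n₂+1)(n₃+1) + 1`. -/
theorem construction4_even (n₁ n₂ n₃ : ℕ) (h₁ : 0 < n₁) (h₂ : 0 < n₂) (h₃ : 0 < n₃)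
    (e₁ : Even n₁) (e₂ : Even n₂) (e₃ : Even n₃) :
    borderRank (spider3 (n₁ + 1) (n₂ + 1) (n₃ + 1)) = (n₁ + 1) * (n₂ + 1) * (n₃ + 1) ∧
    borderRank (ghz4 (n₁ * n₂ * n₃ / 4)) = n₁ * n₂ * n₃ / 4 ∧
    borderRank (dsum (spider3 (n₁ + 1) (n₂ + 1) (n₃ + 1)) (ghz4 (n₁ * n₂ * n₃ / 4))) =
      (n₁ + 1) * (n₂ + 1) * (n₃ + 1) + 1 := by
  obtain ⟨k₁, rfl⟩ := e₁
  obtain ⟨k₂, rfl⟩ := e₂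
  obtain ⟨k₃, rfl⟩ := e₃
  have hM : (k₁ + k₁) * (k₂ + k₂) * (k₃ + k₃) / 4 = 2 * (k₁ * k₂ * k₃) :=
    Nat.div_eq_of_eq_mul_left (by norm_num) (by ring)
  have hM0 : 0 < (k₁ + k₁) * (k₂ + k₂) * (k₃ + k₃) / 4 := by
    have : 0 < k₁ := by omega
    have : 0 < k₂ := by omega
    have : 0 < k₃ := by omega
    rw [hM]
    positivity
  exact ⟨borderRank_spider3 _ _ _, borderRank_ghz4 _, borderRank_eq
    (hasBorderRankLE_dsum_spider3_ghz4 (by ring) (by ring) (by ring) hM hM0)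
    fun s hs => le_of_hasBorderRankLE_dsum hM0 hs⟩

end
end Subadditivity
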